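/- arXiv:2312.03784 — 2 statements merged into one kernel-verified Lean document; each statement's English description precedes it below -/
import Mathlib

section
/- For every probability distribution P on 𝒳, every Δ ≥ 0, and every R ≥ 0, the Marton exponent dominates the Blahut exponent: E_M(R|Δ,P) ≥ E_B(R|Δ,P). -/
open scoped BigOperators

/-- `p` is a probability distribution on the finite set `X`. -/
def IsDist {X : Type*} [Fintype X] (p : X → ℝ) : Prop :=
  (∀ x, 0 ≤ p x) ∧ ∑ x, p x = 1

/-- `V` is a conditional probability distribution on `Y` given `X`. -/
def IsCondDist {X Y : Type*} [Fintype Y] (V : X → Y → ℝ) : Prop :=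
  ∀ x, IsDist (V x)

/-- Mutual information `I(q,V)` with the convention `0 log 0 = 0`. -/
noncomputable def mutInfo {X Y : Type*} [Fintype X] [Fintype Y]
    (q : X → ℝ) (V : X → Y → ℝ) : ℝ :=
  ∑ x, ∑ y, if q x * V x y = 0 then 0
    else q x * V x y * Real.log (V x y / ∑ x', q x' * V x' y)

/-- The rate-distortion function `R(Δ|q)`. -/
noncomputable def rateDist {X Y : Type*} [Fintype X] [Fintype Y]
    (d : X → Y → ℝ) (Δ : ℝ) (q : X → ℝ) : ℝ :=
  sInf { r | ∃ V : X → Y → ℝ, IsCondDist V ∧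
    (∑ x, ∑ y, q x * V x y * d x y) ≤ Δ ∧ r = mutInfo q V }

/-- Relative entropy `D(q‖P)` (real-valued; convention `0 log 0 = 0`). -/
noncomputable def relEnt {X : Type*} [Fintype X] (q P : X → ℝ) : ℝ :=
  ∑ x, if q x = 0 then 0 else q x * Real.log (q x / P x)

/-- Absolute continuity: `q(x) = 0` whenever `P(x) = 0` (finiteness of `D(q‖P)`). -/
def AbsCont {X : Type*} (q P : X → ℝ) : Prop := ∀ x, P x = 0 → q x = 0

open Real Set Filter Topology

section Distributions

variable {X : Type*}

lemma convex_absCont (P : X → ℝ) : Convex ℝ {q : X → ℝ | AbsCont q P} := by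
  intro q hq q' hq' s t _ _ _ x hx
  simp [hq x hx, hq' x hx]

lemma isClosed_absCont (P : X → ℝ) : IsClosed {q : X → ℝ | AbsCont q P} := by
  have : {q : X → ℝ | AbsCont q P} = ⋂ x, ⋂ (_ : P x = 0), {q | q x = 0} := by
    ext q
    simp [AbsCont]
  rw [this]
  exact isClosed_iInter fun x ↦ isClosed_iInter fun _ ↦
    isClosed_eq (continuous_apply x) continuous_const

variable [Fintype X]

/-- The distributions on `X` that are absolutely continuous with respect to `P`. -/
def distAbsCont (P : X → ℝ) : Set (X → ℝ) := {q | IsDist q ∧ AbsCont q P}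

lemma setOf_isDist : {p : X → ℝ | IsDist p} = stdSimplex ℝ X := by
  ext p
  simp [IsDist, stdSimplex]

lemma isDist_single [DecidableEq X] (x : X) : IsDist (Pi.single x 1 : X → ℝ) := by
  refine ⟨fun z ↦ ?_, by simp⟩
  by_cases h : z = x
  · subst h; simp
  · simp [h]

lemma single_mem_distAbsCont [DecidableEq X] {P : X → ℝ} {x : X} (hx : P x ≠ 0) :
    (Pi.single x 1 : X → ℝ) ∈ distAbsCont P :=
  ⟨isDist_single x, fun z hz ↦ by
    rw [Pi.single_eq_of_ne]
    rintro rfl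
    exact hx hz⟩

lemma convex_isDist : Convex ℝ {p : X → ℝ | IsDist p} := by
  rw [setOf_isDist]
  exact convex_stdSimplex ℝ X

lemma isCompact_isDist : IsCompact {p : X → ℝ | IsDist p} := by
  rw [setOf_isDist]
  exact isCompact_stdSimplex ℝ X

lemma convex_distAbsCont (P : X → ℝ) : Convex ℝ (distAbsCont P) :=
  convex_isDist.inter (convex_absCont P)

lemma isCompact_distAbsCont (P : X → ℝ) : IsCompact (distAbsCont P) :=
  isCompact_isDist.inter_right (isClosed_absCont P)

lemma IsDist.sum_mul_le_of_le {q : X → ℝ} (hq : IsDist q) {u : X → ℝ} {c : ℝ}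
    (h : ∀ x, q x ≠ 0 → u x ≤ c) : ∑ x, q x * u x ≤ c := by
  calc ∑ x, q x * u x ≤ ∑ x, q x * c := by
        refine Finset.sum_le_sum fun x _ ↦ ?_
        by_cases hx : q x = 0
        · simp [hx]
        · exact mul_le_mul_of_nonneg_left (h x hx) (hq.1 x)
    _ = c := by rw [← Finset.sum_mul, hq.2, one_mul]

lemma IsDist.le_sum_mul_of_le {q : X → ℝ} (hq : IsDist q) {u : X → ℝ} {c : ℝ}
    (h : ∀ x, q x ≠ 0 → c ≤ u x) : c ≤ ∑ x, q x * u x := by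
  calc c = ∑ x, q x * c := by rw [← Finset.sum_mul, hq.2, one_mul]
    _ ≤ ∑ x, q x * u x := by
        refine Finset.sum_le_sum fun x _ ↦ ?_
        by_cases hx : q x = 0
        · simp [hx]
        · exact mul_le_mul_of_nonneg_left (h x hx) (hq.1 x)

end Distributions

section CondDistributions

variable {X Y : Type*} [Fintype Y]

lemma setOf_isCondDist :
    {V : X → Y → ℝ | IsCondDist V} = Set.pi univ fun _ ↦ {p : Y → ℝ | IsDist p} := by
  ext V
  simp [IsCondDist]

lemma convex_isCondDist : Convex ℝ {V : X → Y → ℝ | IsCondDist V} := by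
  rw [setOf_isCondDist]
  exact convex_pi fun _ _ ↦ convex_isDist

lemma isCompact_isCondDist : IsCompact {V : X → Y → ℝ | IsCondDist V} := by
  rw [setOf_isCondDist]
  exact isCompact_univ_pi fun _ ↦ isCompact_isDist

lemma isCondDist_single [DecidableEq Y] (w : X → Y) :
    IsCondDist fun x ↦ (Pi.single (w x) 1 : Y → ℝ) :=
  fun x ↦ isDist_single (w x)

end CondDistributions

section Information

variable {X Y : Type*} [Fintype X]

/-- The tangent-line bound for the convex function `(v, r) ↦ v * log (v / r)`. -/
lemma mul_log_add_sub_le_mul_log_div {v r c : ℝ} (hv : 0 ≤ v) (hr : 0 ≤ r) (hvr : r = 0 → v = 0)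
    (hc : 0 < c) : v * log c + v - c * r ≤ v * log (v / r) := by
  rcases hv.eq_or_lt with rfl | hv
  · simpa using mul_nonneg hc.le hr
  have hr : 0 < r := hr.lt_of_ne fun h ↦ hv.ne' (hvr h.symm)
  have h := log_le_sub_one_of_pos (show 0 < c * r / v by positivity)
  rw [log_div (by positivity) hv.ne', log_mul hc.ne' hr.ne'] at h
  rw [log_div hv.ne' hr.ne']
  have h' := mul_le_mul_of_nonneg_left h hv.le
  have : v * (c * r / v - 1) = c * r - v := by field_simp
  linarith

/-- The output distribution of the channel `V` with input distribution `q`. -/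
def outDist (q : X → ℝ) (V : X → Y → ℝ) (y : Y) : ℝ := ∑ x, q x * V x y

lemma outDist_nonneg {q : X → ℝ} {V : X → Y → ℝ} (hq : ∀ x, 0 ≤ q x) (hV : ∀ x y, 0 ≤ V x y)
    (y : Y) : 0 ≤ outDist q V y :=
  Finset.sum_nonneg fun x _ ↦ mul_nonneg (hq x) (hV x y)

lemma mul_eq_zero_of_outDist_eq_zero {q : X → ℝ} {V : X → Y → ℝ} (hq : ∀ x, 0 ≤ q x)
    (hV : ∀ x y, 0 ≤ V x y) {y : Y} (h : outDist q V y = 0) (x : X) : q x * V x y = 0 :=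
  (Finset.sum_eq_zero_iff_of_nonneg fun x _ ↦ mul_nonneg (hq x) (hV x y)).1 h x
    (Finset.mem_univ x)

variable [Fintype Y]

/-- The expected distortion of the channel `V` with input distribution `q`. -/
def expDist (d : X → Y → ℝ) (q : X → ℝ) (V : X → Y → ℝ) : ℝ := ∑ x, ∑ y, q x * V x y * d x y

lemma sum_sum_mul {q : X → ℝ} {V : X → Y → ℝ} (hV : IsCondDist V) (u : X → ℝ) :
    ∑ x, ∑ y, q x * V x y * u x = ∑ x, q x * u x := by
  refine Finset.sum_congr rfl fun x _ ↦ ?_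
  rw [← Finset.sum_mul, ← Finset.mul_sum, (hV x).2, mul_one]

lemma sum_sum_eq_one {q : X → ℝ} {V : X → Y → ℝ} (hq : IsDist q) (hV : IsCondDist V) :
    ∑ x, ∑ y, q x * V x y = 1 := by
  simpa [hq.2] using sum_sum_mul (q := q) hV fun _ ↦ 1

lemma sum_outDist {q : X → ℝ} {V : X → Y → ℝ} (hq : IsDist q) (hV : IsCondDist V) :
    ∑ y, outDist q V y = 1 := by
  simp only [outDist]
  rw [Finset.sum_comm, sum_sum_eq_one hq hV]

lemma sum_sum_mul_outDist (q : X → ℝ) (V : X → Y → ℝ) (u : Y → ℝ) :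
    ∑ x, ∑ y, q x * V x y * u y = ∑ y, outDist q V y * u y := by
  rw [Finset.sum_comm]
  exact Finset.sum_congr rfl fun y _ ↦ by rw [outDist, Finset.sum_mul]

lemma mutInfo_eq (q : X → ℝ) (V : X → Y → ℝ) :
    mutInfo q V = ∑ x, ∑ y, q x * V x y * log (V x y / outDist q V y) := by
  refine Finset.sum_congr rfl fun x _ ↦ Finset.sum_congr rfl fun y _ ↦ ?_
  split_ifs with h
  · rw [h, zero_mul]
  · rfl

lemma mutInfo_eq_negMulLog {q : X → ℝ} {V : X → Y → ℝ} (hq : ∀ x, 0 ≤ q x)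
    (hV : ∀ x y, 0 ≤ V x y) :
    mutInfo q V = ∑ y, negMulLog (outDist q V y) - ∑ x, ∑ y, q x * negMulLog (V x y) := by
  have h : ∀ y, negMulLog (outDist q V y) = outDist q V y * -log (outDist q V y) :=
    fun y ↦ by rw [negMulLog]; ring
  simp_rw [mutInfo_eq, h]
  rw [← sum_sum_mul_outDist, ← Finset.sum_sub_distrib]
  refine Finset.sum_congr rfl fun x _ ↦ ?_
  rw [← Finset.sum_sub_distrib]
  refine Finset.sum_congr rfl fun y _ ↦ ?_
  by_cases h0 : q x * V x y = 0
  · rcases mul_eq_zero.1 h0 with h | h <;> simp [h]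
  · rw [log_div (right_ne_zero_of_mul h0)
      fun h ↦ h0 (mul_eq_zero_of_outDist_eq_zero hq hV h x), negMulLog]
    ring

lemma continuousOn_mutInfo :
    ContinuousOn (fun z : (X → ℝ) × (X → Y → ℝ) ↦ mutInfo z.1 z.2)
      {z | (∀ x, 0 ≤ z.1 x) ∧ ∀ x y, 0 ≤ z.2 x y} := by
  have hV (x : X) (y : Y) : Continuous fun z : (X → ℝ) × (X → Y → ℝ) ↦ z.2 x y := by fun_prop
  have hq (x : X) : Continuous fun z : (X → ℝ) × (X → Y → ℝ) ↦ z.1 x := by fun_prop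
  have hr (y : Y) : Continuous fun z : (X → ℝ) × (X → Y → ℝ) ↦ outDist z.1 z.2 y :=
    continuous_finsetSum _ fun x _ ↦ (hq x).mul (hV x y)
  have h : Continuous fun z : (X → ℝ) × (X → Y → ℝ) ↦ ∑ y, negMulLog (outDist z.1 z.2 y) -
      ∑ x, ∑ y, z.1 x * negMulLog (z.2 x y) :=
    (continuous_finsetSum _ fun y _ ↦ continuous_negMulLog.comp (hr y)).sub
      (continuous_finsetSum _ fun x _ ↦ continuous_finsetSum _ fun y _ ↦
        (hq x).mul (continuous_negMulLog.comp (hV x y)))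
  exact h.continuousOn.congr fun z hz ↦ mutInfo_eq_negMulLog hz.1 hz.2

lemma continuousOn_mutInfo_left {V : X → Y → ℝ} (hV : IsCondDist V) :
    ContinuousOn (fun q ↦ mutInfo q V) {q | IsDist q} :=
  continuousOn_mutInfo.comp (f := fun q ↦ (q, V)) (by fun_prop)
    fun _ hq ↦ ⟨hq.1, fun x ↦ (hV x).1⟩

lemma continuousOn_mutInfo_right {q : X → ℝ} (hq : IsDist q) :
    ContinuousOn (fun V : X → Y → ℝ ↦ mutInfo q V) {V | IsCondDist V} :=
  continuousOn_mutInfo.comp (f := fun V ↦ (q, V)) (by fun_prop)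
    fun _ hV ↦ ⟨hq.1, fun x ↦ (hV x).1⟩

lemma convexOn_mutInfo {q : X → ℝ} (hq : IsDist q) :
    ConvexOn ℝ {V : X → Y → ℝ | IsCondDist V} (mutInfo q) := by
  refine ⟨convex_isCondDist, fun V hV W hW s t hs ht hst ↦ ?_⟩
  simp only [mutInfo_eq, smul_eq_mul, Finset.mul_sum, ← Finset.sum_add_distrib]
  refine Finset.sum_le_sum fun x _ ↦ Finset.sum_le_sum fun y _ ↦ ?_
  have hU := convex_isCondDist hV hW hs ht hst
  set U := s • V + t • W with hUdef
  have hUx : U x y = s * V x y + t * W x y := rfl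
  have hr : outDist q U y = s * outDist q V y + t * outDist q W y := by
    simp only [outDist, Finset.mul_sum, ← Finset.sum_add_distrib]
    refine Finset.sum_congr rfl fun z _ ↦ ?_
    have hUz : U z y = s * V z y + t * W z y := rfl
    rw [hUz]
    ring
  have h0 (V : X → Y → ℝ) (hV : IsCondDist V) (hqx : q x ≠ 0) (h : outDist q V y = 0) :
      V x y = 0 :=
    (mul_eq_zero.1 (mul_eq_zero_of_outDist_eq_zero hq.1 (fun x ↦ (hV x).1) h x)).resolve_left hqx
  by_cases hqx : q x = 0
  · simp [hqx]
  rcases ((hU x).1 y).eq_or_lt with hU0 | hU0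
  · have h1 : s * V x y = 0 := by
      nlinarith [mul_nonneg hs ((hV x).1 y), mul_nonneg ht ((hW x).1 y)]
    have h2 : t * W x y = 0 := by
      nlinarith [mul_nonneg hs ((hV x).1 y), mul_nonneg ht ((hW x).1 y)]
    rw [← hU0]
    rcases mul_eq_zero.1 h1 with h1 | h1 <;> rcases mul_eq_zero.1 h2 with h2 | h2 <;>
      simp [h1, h2]
  · have hrU : 0 < outDist q U y :=
      (outDist_nonneg hq.1 (fun x ↦ (hU x).1) y).lt_of_ne fun h ↦ hU0.ne' (h0 U hU hqx h.symm)
    have hc : 0 < U x y / outDist q U y := by positivity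
    have h1 := mul_log_add_sub_le_mul_log_div ((hV x).1 y)
      (outDist_nonneg hq.1 (fun x ↦ (hV x).1) y) (h0 V hV hqx) hc
    have h2 := mul_log_add_sub_le_mul_log_div ((hW x).1 y)
      (outDist_nonneg hq.1 (fun x ↦ (hW x).1) y) (h0 W hW hqx) hc
    have h3 : U x y / outDist q U y * outDist q U y = U x y := by field_simp
    set L := log (U x y / outDist q U y)
    set c := U x y / outDist q U y
    have h4 : U x y * L ≤ s * (V x y * log (V x y / outDist q V y)) +
        t * (W x y * log (W x y / outDist q W y)) := by
      have h1' := mul_le_mul_of_nonneg_left h1 hs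
      have h2' := mul_le_mul_of_nonneg_left h2 ht
      rw [hr] at h3
      rw [hUx] at h3 ⊢
      linarith
    have h5 := mul_le_mul_of_nonneg_left h4 (hq.1 x)
    linarith

lemma neg_log_le_mutInfo_add {q : X → ℝ} {V : X → Y → ℝ} {d : X → Y → ℝ} {ν t : ℝ}
    (hq : IsDist q) (hV : IsCondDist V) (ht : 0 < t)
    (h : ∀ y, ∑ x, q x * exp (-ν * d x y) ≤ t) :
    -log t ≤ mutInfo q V + ν * expDist d q V := by
  have key : ∀ x y, q x * V x y * (-ν * d x y) - q x * V x y * log t + q x * V x y -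
      q x * exp (-ν * d x y) * (outDist q V y / t) ≤
        q x * V x y * log (V x y / outDist q V y) := by
    intro x y
    by_cases hqx : q x = 0
    · simp [hqx]
    have h1 := mul_log_add_sub_le_mul_log_div ((hV x).1 y)
      (outDist_nonneg hq.1 (fun x ↦ (hV x).1) y)
      (fun h ↦ (mul_eq_zero.1
        (mul_eq_zero_of_outDist_eq_zero hq.1 (fun x ↦ (hV x).1) h x)).resolve_left hqx)
      (show 0 < exp (-ν * d x y) / t by positivity)
    rw [log_div (exp_ne_zero _) ht.ne', log_exp] at h1
    have h2 := mul_le_mul_of_nonneg_left h1 (hq.1 x)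
    refine le_trans (le_of_eq ?_) (h2.trans (le_of_eq ?_)) <;> ring
  have hsum := Finset.sum_le_sum fun x (_ : x ∈ Finset.univ) ↦
    Finset.sum_le_sum fun y (_ : y ∈ Finset.univ) ↦ key x y
  simp only [Finset.sum_sub_distrib, Finset.sum_add_distrib] at hsum
  rw [← mutInfo_eq, sum_sum_mul hV fun _ ↦ log t, sum_sum_eq_one hq hV, ← Finset.sum_mul, hq.2]
    at hsum
  have h1 : ∑ x, ∑ y, q x * V x y * (-ν * d x y) = -(ν * expDist d q V) := by
    simp only [expDist, Finset.mul_sum, ← Finset.sum_neg_distrib]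
    exact Finset.sum_congr rfl fun x _ ↦ Finset.sum_congr rfl fun y _ ↦ by ring
  have h2 : ∑ x, ∑ y, q x * exp (-ν * d x y) * (outDist q V y / t) ≤ 1 := by
    rw [Finset.sum_comm, ← sum_outDist hq hV]
    refine Finset.sum_le_sum fun y _ ↦ ?_
    rw [← Finset.sum_mul]
    calc _ ≤ t * (outDist q V y / t) := mul_le_mul_of_nonneg_right (h y)
          (div_nonneg (outDist_nonneg hq.1 (fun x ↦ (hV x).1) y) ht.le)
      _ = outDist q V y := by field_simp
  linarith

lemma mutInfo_nonneg {q : X → ℝ} {V : X → Y → ℝ} (hq : IsDist q) (hV : IsCondDist V) :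
    0 ≤ mutInfo q V := by
  simpa using neg_log_le_mutInfo_add (d := 0) (ν := 0) hq hV one_pos (by simp [hq.2])

/-- Mutual information is bounded by the conditional divergence from any output distribution. -/
lemma mutInfo_le_sum_log_div {q : X → ℝ} {V : X → Y → ℝ} {p : Y → ℝ} (hq : IsDist q)
    (hV : IsCondDist V) (hp : IsDist p) (hpV : ∀ x y, p y = 0 → V x y = 0) :
    mutInfo q V ≤ ∑ x, ∑ y, q x * V x y * log (V x y / p y) := by
  have h1 : 0 ≤ ∑ y, outDist q V y * log (outDist q V y / p y) := by
    have := Finset.sum_le_sum fun y (_ : y ∈ Finset.univ) ↦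
      mul_log_add_sub_le_mul_log_div (outDist_nonneg hq.1 (fun x ↦ (hV x).1) y) (hp.1 y)
        (fun h ↦ Finset.sum_eq_zero fun x _ ↦ by rw [hpV x y h, mul_zero]) one_pos
    simpa [Finset.sum_sub_distrib, sum_outDist hq hV, hp.2] using this
  rw [← sum_sum_mul_outDist] at h1
  rw [mutInfo_eq, ← sub_nonneg]
  refine h1.trans (le_of_eq ?_)
  rw [← Finset.sum_sub_distrib]
  refine Finset.sum_congr rfl fun x _ ↦ ?_
  rw [← Finset.sum_sub_distrib]
  refine Finset.sum_congr rfl fun y _ ↦ ?_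
  by_cases h0 : q x * V x y = 0
  · simp [h0]
  have hV0 : V x y ≠ 0 := right_ne_zero_of_mul h0
  have hr0 : outDist q V y ≠ 0 :=
    fun h ↦ h0 (mul_eq_zero_of_outDist_eq_zero hq.1 (fun x ↦ (hV x).1) h x)
  have hp0 : p y ≠ 0 := fun h ↦ hV0 (hpV x y h)
  rw [log_div hr0 hp0, log_div hV0 hp0, log_div hV0 hr0]
  ring

/-- The Gibbs variational inequality. -/
lemma sum_mul_log_sub_relEnt_le {q P u : X → ℝ} (hq : IsDist q) (hP : IsDist P)
    (hqP : AbsCont q P) (hu : ∀ x, 0 < u x) :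
    ∑ x, q x * log (u x) - relEnt q P ≤ log (∑ x, P x * u x) := by
  have hZ : 0 < ∑ x, P x * u x := by
    obtain ⟨x, -, hx⟩ := Finset.exists_ne_zero_of_sum_ne_zero (hP.2.trans_ne one_ne_zero)
    exact Finset.sum_pos' (fun x _ ↦ mul_nonneg (hP.1 x) (hu x).le)
      ⟨x, Finset.mem_univ x, mul_pos ((hP.1 x).lt_of_ne' hx) (hu x)⟩
  set Z := ∑ x, P x * u x
  have hrel : relEnt q P = ∑ x, q x * log (q x / P x) :=
    Finset.sum_congr rfl fun x _ ↦ by split_ifs with h <;> simp [h]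
  have hsum := Finset.sum_le_sum fun x (_ : x ∈ Finset.univ) ↦
    mul_log_add_sub_le_mul_log_div (hq.1 x) (hP.1 x) (hqP x) (div_pos (hu x) hZ)
  simp only [log_div (hu _).ne' hZ.ne', mul_sub, Finset.sum_sub_distrib, Finset.sum_add_distrib]
    at hsum
  have h1 : ∑ x, u x / Z * P x = 1 := by
    rw [← div_self hZ.ne', Finset.sum_div]
    exact Finset.sum_congr rfl fun x _ ↦ by ring
  rw [← hrel, ← Finset.sum_mul, hq.2, h1] at hsum
  linarith

lemma relEnt_nonneg {q P : X → ℝ} (hq : IsDist q) (hP : IsDist P) (hqP : AbsCont q P) :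
    0 ≤ relEnt q P := by
  simpa [hP.2] using sum_mul_log_sub_relEnt_le hq hP hqP fun _ ↦ one_pos

end Information

section Minimax

/-- A minimax principle for convex-concave functions in which only one of the two sets is
compact. -/
lemma exists_forall_lt_of_forall_exists_lt {E F : Type*}
    [TopologicalSpace E] [AddCommGroup E] [Module ℝ E] [IsTopologicalAddGroup E]
    [ContinuousSMul ℝ E] [TopologicalSpace F] [AddCommGroup F] [Module ℝ F]
    [IsTopologicalAddGroup F] [ContinuousSMul ℝ F] {A : Set E} {B : Set F} {f : E → F → ℝ} {t : ℝ}
    (hA : A.Nonempty) (hAc : IsCompact A) (hB : Convex ℝ B)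
    (hf : ∀ y ∈ B, ContinuousOn (fun x ↦ f x y) A)
    (hf' : ∀ y ∈ B, ConvexOn ℝ A fun x ↦ f x y)
    (hg : ∀ x ∈ A, ContinuousOn (fun y ↦ f x y) B)
    (hg' : ∀ x ∈ A, ConcaveOn ℝ B fun y ↦ f x y)
    (h : ∀ x ∈ A, ∃ y ∈ B, t < f x y) : ∃ y ∈ B, ∀ x ∈ A, t < f x y := by
  have hlsc : ∀ y ∈ B, LowerSemicontinuousOn (fun x ↦ f x y) A :=
    fun y hy ↦ (hf y hy).lowerSemicontinuousOn
  obtain ⟨s, hs⟩ : ∃ s : Finset B, ∀ x ∈ A, ∃ y ∈ s, t < f x y := by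
    refine (LowerSemicontinuousOn.inter_biInter_preimage_Iic_eq_empty_iff_exists_finset
      (f := fun y x ↦ f x y) hAc hlsc).1 (Set.eq_empty_of_forall_notMem ?_)
    rintro x ⟨hx, hx'⟩
    obtain ⟨y, hy, hty⟩ := h x hx
    exact hty.not_ge (Set.mem_iInter₂.1 hx' y hy)
  obtain ⟨x, hx⟩ := hA
  obtain ⟨y, hy, -⟩ := h x hx
  refine Sion.exists_lt_iInf_of_lt_iInf_of_finite ⟨x, hx⟩ hAc hlsc
    (fun y hy ↦ (hf' y hy).quasiconvexOn) hB (fun x hx ↦ (hg x hx).upperSemicontinuousOn)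
    (fun x hx ↦ (hg' x hx).quasiconcaveOn) (hf' y hy).1
    (s := Set.image Subtype.val (s : Set B)) (Set.toFinite _) (Subtype.coe_image_subset B _) ?_
  intro x hx
  obtain ⟨y, hy, hty⟩ := hs x hx
  exact ⟨y, ⟨y, hy, rfl⟩, hty⟩

end Minimax

section Tilt

variable {X Y : Type*} [Fintype Y]

/-- The partition function of the exponential tilting of `p` by the distortion. -/
noncomputable def tilt (d : X → Y → ℝ) (ν : ℝ) (p : Y → ℝ) (x : X) : ℝ :=
  ∑ y, p y * exp (-ν * d x y)

lemma tilt_pos {p : Y → ℝ} (hp : IsDist p) (d : X → Y → ℝ) (ν : ℝ) (x : X) :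
    0 < tilt d ν p x := by
  obtain ⟨y, -, hy⟩ := Finset.exists_ne_zero_of_sum_ne_zero (hp.2.trans_ne one_ne_zero)
  exact Finset.sum_pos' (fun y _ ↦ mul_nonneg (hp.1 y) (exp_pos _).le)
    ⟨y, Finset.mem_univ y, mul_pos ((hp.1 y).lt_of_ne' hy) (exp_pos _)⟩

lemma tilt_le {p : Y → ℝ} (hp : IsDist p) {d : X → Y → ℝ} {ν c : ℝ} (hν : 0 ≤ ν)
    {x : X} (h : ∀ y, c ≤ d x y) :
    tilt d ν p x ≤ exp (-ν * c) :=
  hp.sum_mul_le_of_le fun y _ ↦ exp_le_exp.2 (by nlinarith [h y])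

end Tilt

section RateDistortion

variable {X Y : Type*} [Fintype X] [Fintype Y] {d : X → Y → ℝ} {q : X → ℝ} {Δ : ℝ}

lemma expDist_eq (d : X → Y → ℝ) (q : X → ℝ) (V : X → Y → ℝ) :
    expDist d q V = ∑ x, q x * ∑ y, V x y * d x y := by
  simp only [expDist, Finset.mul_sum, mul_assoc]

lemma expDist_add_smul (d : X → Y → ℝ) (q : X → ℝ) (V W : X → Y → ℝ) (s t : ℝ) :
    expDist d q (s • V + t • W) = s * expDist d q V + t * expDist d q W := by
  simp only [expDist, Finset.mul_sum, ← Finset.sum_add_distrib]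
  refine Finset.sum_congr rfl fun x _ ↦ Finset.sum_congr rfl fun y _ ↦ ?_
  simp only [Pi.add_apply, Pi.smul_apply, smul_eq_mul]
  ring

lemma expDist_single [DecidableEq Y] (d : X → Y → ℝ) (q : X → ℝ) (w : X → Y) :
    expDist d q (fun x ↦ Pi.single (w x) 1) = ∑ x, q x * d x (w x) := by
  simp [expDist_eq, Pi.single_apply]

lemma continuous_expDist_left (d : X → Y → ℝ) (V : X → Y → ℝ) :
    Continuous fun q ↦ expDist d q V := by
  unfold expDist
  fun_prop

lemma continuous_expDist_right (d : X → Y → ℝ) (q : X → ℝ) :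
    Continuous fun V : X → Y → ℝ ↦ expDist d q V := by
  have hV (x : X) (y : Y) : Continuous fun V : X → Y → ℝ ↦ V x y := by fun_prop
  exact continuous_finsetSum _ fun x _ ↦ continuous_finsetSum _ fun y _ ↦
    (continuous_const.mul (hV x y)).mul continuous_const

lemma rateDist_le {V : X → Y → ℝ} (hq : IsDist q) (hV : IsCondDist V)
    (h : expDist d q V ≤ Δ) : rateDist d Δ q ≤ mutInfo q V := by
  refine csInf_le ⟨0, ?_⟩ ⟨V, hV, h, rfl⟩
  rintro _ ⟨W, hW, -, rfl⟩
  exact mutInfo_nonneg hq hW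

lemma le_rateDist {W : X → Y → ℝ} {b : ℝ} (hW : IsCondDist W) (hWΔ : expDist d q W ≤ Δ)
    (h : ∀ V, IsCondDist V → expDist d q V ≤ Δ → b ≤ mutInfo q V) : b ≤ rateDist d Δ q := by
  refine le_csInf ⟨_, W, hW, hWΔ, rfl⟩ ?_
  rintro _ ⟨V, hV, hVΔ, rfl⟩
  exact h V hV hVΔ

lemma exists_mutInfo_lt {W : X → Y → ℝ} {b : ℝ} (hW : IsCondDist W) (hWΔ : expDist d q W ≤ Δ)
    (h : rateDist d Δ q < b) : ∃ V, IsCondDist V ∧ expDist d q V ≤ Δ ∧ mutInfo q V < b := by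
  by_contra! hcon
  exact h.not_ge (le_rateDist hW hWΔ hcon)

/-- Strong Lagrange duality for the rate-distortion function. -/
lemma exists_multiplier_of_lt_rateDist [Nonempty Y] {b : ℝ} (hq : IsDist q)
    (hb : b < rateDist d Δ q) :
    ∃ ν, 0 ≤ ν ∧ ∀ V, IsCondDist V → b < mutInfo q V + ν * (expDist d q V - Δ) := by
  classical
  refine exists_forall_lt_of_forall_exists_lt (A := {V | IsCondDist V}) (B := Set.Ici 0)
    (f := fun V ν ↦ mutInfo q V + ν * (expDist d q V - Δ))
    ⟨_, isCondDist_single fun _ ↦ Classical.arbitrary Y⟩ isCompact_isCondDist (convex_Ici 0)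
    (fun ν _ ↦ ?_) (fun ν _ ↦ ?_) (fun V _ ↦ by fun_prop) (fun V _ ↦ ?_) fun V hV ↦ ?_
  · exact (continuousOn_mutInfo_right hq).add
      (continuous_const.mul ((continuous_expDist_right d q).sub continuous_const)).continuousOn
  · refine (convexOn_mutInfo hq).add ⟨convex_isCondDist, fun V _ W _ s t _ _ hst ↦ le_of_eq ?_⟩
    simp only [smul_eq_mul, expDist_add_smul]
    linear_combination ν * Δ * hst
  · refine ⟨convex_Ici 0, fun ν _ μ _ s t _ _ hst ↦ le_of_eq ?_⟩
    simp only [smul_eq_mul]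
    linear_combination mutInfo q V * hst
  · rcases le_or_gt (expDist d q V) Δ with h | h
    · exact ⟨0, Set.self_mem_Ici, by simpa using hb.trans_le (rateDist_le hq hV h)⟩
    · have h' : 0 < expDist d q V - Δ := sub_pos.2 h
      refine ⟨(|b| + 1) / (expDist d q V - Δ), Set.mem_Ici.2 (by positivity), ?_⟩
      rw [div_mul_cancel₀ _ h'.ne']
      linarith [mutInfo_nonneg hq hV, le_abs_self b]

/-- The tilted channel bounds the Lagrangian of the rate-distortion problem. -/
lemma exists_mutInfo_add_le {p : Y → ℝ} (hq : IsDist q) (hp : IsDist p) (d : X → Y → ℝ) (ν : ℝ) :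
    ∃ V, IsCondDist V ∧ mutInfo q V + ν * expDist d q V ≤ -∑ x, q x * log (tilt d ν p x) := by
  set V : X → Y → ℝ := fun x y ↦ p y * exp (-ν * d x y) / tilt d ν p x with hVdef
  have hV : IsCondDist V := fun x ↦
    ⟨fun y ↦ div_nonneg (mul_nonneg (hp.1 y) (exp_pos _).le) (tilt_pos hp d ν x).le, by
      rw [← Finset.sum_div]
      exact div_self (tilt_pos hp d ν x).ne'⟩
  refine ⟨V, hV, ?_⟩
  have h := mutInfo_le_sum_log_div hq hV hp fun x y h ↦ by simp [hVdef, h]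
  have hterm : ∑ x, ∑ y, q x * V x y * log (V x y / p y) =
      ∑ x, ∑ y, (-ν * (q x * V x y * d x y) - q x * V x y * log (tilt d ν p x)) := by
    refine Finset.sum_congr rfl fun x _ ↦ Finset.sum_congr rfl fun y _ ↦ ?_
    by_cases hy : p y = 0
    · simp [hVdef, hy]
    have : V x y / p y = exp (-ν * d x y) / tilt d ν p x := by
      simp only [hVdef]
      field_simp
    rw [this, log_div (exp_ne_zero _) (tilt_pos hp d ν x).ne', log_exp]
    ring
  simp only [hterm, Finset.sum_sub_distrib, ← Finset.mul_sum] at h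
  rw [sum_sum_mul hV fun x ↦ log (tilt d ν p x)] at h
  change mutInfo q V ≤ -ν * expDist d q V - _ at h
  linarith

/-- A channel nearly optimal at `q` can be chosen admissible at all nearby input
distributions. -/
lemma exists_mutInfo_lt_and_eventually_expDist_le [Nonempty Y] {P : X → ℝ} {R : ℝ}
    (hfeas : ∀ x, P x ≠ 0 → ∃ y, d x y ≤ Δ) (hq : q ∈ distAbsCont P)
    (hR : rateDist d Δ q < R) :
    ∃ V, IsCondDist V ∧ mutInfo q V < R ∧ ∀ᶠ q' in 𝓝[distAbsCont P] q, expDist d q' V ≤ Δ := by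
  classical
  choose w hw using fun x ↦ Finite.exists_min (d x)
  have hwΔ : ∀ x, P x ≠ 0 → d x (w x) ≤ Δ := fun x hx ↦
    let ⟨y, hy⟩ := hfeas x hx
    (hw x y).trans hy
  have hWΔ : ∀ q' ∈ distAbsCont P, ∑ x, q' x * d x (w x) ≤ Δ := fun q' hq' ↦
    hq'.1.sum_mul_le_of_le fun x hx ↦ hwΔ x fun h ↦ hx (hq'.2 x h)
  set W : X → Y → ℝ := fun x ↦ Pi.single (w x) 1 with hWdef
  have hW : IsCondDist W := isCondDist_single w
  have hWq : expDist d q W = ∑ x, q x * d x (w x) := expDist_single d q w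
  obtain ⟨V, hV, hVΔ, hVR⟩ := exists_mutInfo_lt hW (hWq.trans_le (hWΔ q hq)) hR
  rcases (hWΔ q hq).lt_or_eq with hlt | heq
  · have hcont : Tendsto (fun ε : ℝ ↦ (1 - ε) * mutInfo q V + ε * mutInfo q W) (𝓝[>] 0)
        (𝓝 ((1 - 0) * mutInfo q V + 0 * mutInfo q W)) :=
      Continuous.tendsto' (by fun_prop) _ _ rfl |>.mono_left nhdsWithin_le_nhds
    obtain ⟨ε, hε, hε0, hε1⟩ := ((hcont.eventually_lt_const (by simpa using hVR)).and
      (Ioo_mem_nhdsGT (zero_lt_one' ℝ))).exists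
    have h1ε : 0 ≤ 1 - ε := by linarith
    have hsum : 1 - ε + ε = 1 := by ring
    refine ⟨(1 - ε) • V + ε • W, convex_isCondDist hV hW h1ε hε0.le hsum,
      ((convexOn_mutInfo hq.1).2 hV hW h1ε hε0.le hsum).trans_lt hε, ?_⟩
    have hlt' : expDist d q ((1 - ε) • V + ε • W) < Δ := by
      rw [expDist_add_smul, hWq]
      nlinarith
    exact nhdsWithin_le_nhds <| ((continuous_expDist_left d _).continuousAt.eventually_lt
      continuousAt_const hlt').mono fun _ h ↦ h.le
  · set U : X → Y → ℝ := fun x ↦ if q x = 0 then W x else V x with hUdef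
    have hU : IsCondDist U := fun x ↦ by
      simp only [hUdef]
      split_ifs
      exacts [hW x, hV x]
    have hqU : ∀ x y, q x * U x y = q x * V x y := fun x y ↦ by
      by_cases h : q x = 0 <;> simp [hUdef, h]
    have hUmut : mutInfo q U = mutInfo q V := by
      have hr : outDist q U = outDist q V := by
        ext y
        exact Finset.sum_congr rfl fun x _ ↦ hqU x y
      rw [mutInfo_eq, mutInfo_eq, hr]
      refine Finset.sum_congr rfl fun x _ ↦ Finset.sum_congr rfl fun y _ ↦ ?_
      by_cases h : q x = 0 <;> simp [hUdef, h]
    have hmin : ∀ x, d x (w x) ≤ ∑ y, V x y * d x y := fun x ↦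
      (hV x).le_sum_mul_of_le fun y _ ↦ hw x y
    have hVx : ∀ x, q x * d x (w x) = q x * ∑ y, V x y * d x y := by
      have hle : ∀ x ∈ Finset.univ, q x * d x (w x) ≤ q x * ∑ y, V x y * d x y :=
        fun x _ ↦ mul_le_mul_of_nonneg_left (hmin x) (hq.1.1 x)
      refine fun x ↦ (Finset.sum_eq_sum_iff_of_le hle).1 ?_ x (Finset.mem_univ x)
      exact (Finset.sum_le_sum hle).antisymm (by rwa [← expDist_eq, heq])
    refine ⟨U, hU, hUmut.trans_lt hVR, eventually_mem_nhdsWithin.mono fun q' hq' ↦ ?_⟩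
    refine le_trans (le_of_eq ?_) (hWΔ q' hq')
    rw [expDist_eq]
    refine Finset.sum_congr rfl fun x _ ↦ ?_
    by_cases h : q x = 0
    · simp [hUdef, hWdef, h, Pi.single_apply]
    · simp [hUdef, h, mul_left_cancel₀ h (hVx x)]

/-- If the rate-distortion function stays below `R`, then it does so uniformly. -/
lemma exists_forall_rateDist_le_sub [Nonempty Y] {P : X → ℝ} {R : ℝ}
    (hfeas : ∀ x, P x ≠ 0 → ∃ y, d x y ≤ Δ) (hR : ∀ q ∈ distAbsCont P, rateDist d Δ q < R) :
    ∃ δ > 0, ∀ q ∈ distAbsCont P, rateDist d Δ q ≤ R - δ := by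
  refine (isCompact_distAbsCont P).induction_on
    (p := fun s ↦ ∃ δ > 0, ∀ q ∈ s, rateDist d Δ q ≤ R - δ) ⟨1, one_pos, by simp⟩
    (fun s t hst ⟨δ, hδ, h⟩ ↦ ⟨δ, hδ, fun q hq ↦ h q (hst hq)⟩) ?_ ?_
  · rintro s t ⟨δ, hδ, hs⟩ ⟨δ', hδ', ht⟩
    refine ⟨min δ δ', lt_min hδ hδ', ?_⟩
    rintro q (hq | hq)
    · linarith [hs q hq, min_le_left δ δ']
    · linarith [ht q hq, min_le_right δ δ']
  · intro q hq
    obtain ⟨V, hV, hVR, hev⟩ := exists_mutInfo_lt_and_eventually_expDist_le hfeas hq (hR q hq)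
    obtain ⟨c, hc, hcR⟩ := exists_between hVR
    have hcont : ContinuousWithinAt (fun q ↦ mutInfo q V) (distAbsCont P) q :=
      (continuousOn_mutInfo_left hV q hq.1).mono fun _ h ↦ h.1
    refine ⟨_, (hev.and (hcont.eventually_lt_const hc)).and eventually_mem_nhdsWithin,
      R - c, sub_pos.2 hcR, ?_⟩
    rintro q' ⟨⟨h1, h2⟩, h3⟩
    linarith [rateDist_le h3.1 hV h1]

end RateDistortion

section Blahut

variable {X Y : Type*} [Fintype X] [Fintype Y] {P : X → ℝ} {d : X → Y → ℝ} {ρ ν Δ R : ℝ}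

/-- The inner minimum in the definition of the Blahut exponent. -/
noncomputable def blahutInf (P : X → ℝ) (d : X → Y → ℝ) (ρ ν : ℝ) : ℝ :=
  sInf { g | ∃ pY : Y → ℝ, IsDist pY ∧ g = log (∑ x, P x * tilt d ν pY x ^ (-ρ)) }

/-- The values over which the infimum in the definition of the Blahut exponent is taken. -/
def blahutValues (P : X → ℝ) (d : X → Y → ℝ) (Δ ρ : ℝ) : Set ℝ :=
  { t | ∃ ν : ℝ, 0 ≤ ν ∧ t = ρ * ν * Δ - blahutInf P d ρ ν }

/-- The set whose supremum is the Blahut exponent. -/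
def blahutSet (P : X → ℝ) (d : X → Y → ℝ) (Δ R : ℝ) : Set ℝ :=
  { v | ∃ ρ : ℝ, 0 ≤ ρ ∧ v = ρ * R + sInf (blahutValues P d Δ ρ) }

lemma blahutValues_nonempty (P : X → ℝ) (d : X → Y → ℝ) (Δ ρ : ℝ) :
    (blahutValues P d Δ ρ).Nonempty :=
  ⟨_, 0, le_rfl, rfl⟩

lemma one_le_sum_mul_tilt_rpow (hP : IsDist P) (hd : ∀ x y, 0 ≤ d x y) (hρ : 0 ≤ ρ) (hν : 0 ≤ ν)
    {p : Y → ℝ} (hp : IsDist p) : 1 ≤ ∑ x, P x * tilt d ν p x ^ (-ρ) :=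
  hP.le_sum_mul_of_le fun x _ ↦ one_le_rpow_of_pos_of_le_one_of_nonpos (tilt_pos hp d ν x)
    (by simpa using tilt_le hp hν (hd x)) (neg_nonpos.2 hρ)

lemma sInf_blahutValues_nonpos (hP : IsDist P) (hd : ∀ x y, 0 ≤ d x y) (hρ : 0 ≤ ρ) :
    sInf (blahutValues P d Δ ρ) ≤ 0 := by
  by_cases hbdd : BddBelow (blahutValues P d Δ ρ)
  · have h : 0 ≤ blahutInf P d ρ 0 := by
      refine Real.sInf_nonneg ?_
      rintro _ ⟨p, hp, rfl⟩
      exact log_nonneg (one_le_sum_mul_tilt_rpow hP hd hρ le_rfl hp)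
    refine (csInf_le (a := ρ * 0 * Δ - blahutInf P d ρ 0) hbdd ⟨0, le_rfl, rfl⟩).trans ?_
    linarith
  · exact (sInf_of_not_bddBelow hbdd).le

lemma blahutInf_le_of_le_tilt (hP : IsDist P) (hd : ∀ x y, 0 ≤ d x y) (hρ : 0 ≤ ρ) (hν : 0 ≤ ν)
    {p : Y → ℝ} (hp : IsDist p) {c : ℝ} (h : ∀ x, P x ≠ 0 → exp c ≤ tilt d ν p x) :
    blahutInf P d ρ ν ≤ -ρ * c := by
  refine le_trans (b := log (∑ x, P x * tilt d ν p x ^ (-ρ))) (csInf_le ⟨0, ?_⟩ ⟨p, hp, rfl⟩) ?_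
  · rintro _ ⟨p, hp, rfl⟩
    exact log_nonneg (one_le_sum_mul_tilt_rpow hP hd hρ hν hp)
  · rw [← log_exp (-ρ * c)]
    refine log_le_log (one_pos.trans_le (one_le_sum_mul_tilt_rpow hP hd hρ hν hp))
      (hP.sum_mul_le_of_le fun x hx ↦ ?_)
    rw [mul_comm, exp_mul]
    exact rpow_le_rpow_of_nonpos (exp_pos c) (h x hx) (neg_nonpos.2 hρ)

lemma sub_relEnt_le_blahutInf [Nonempty Y] (hP : IsDist P) (hρ : 0 ≤ ρ) {q : X → ℝ}
    (hq : q ∈ distAbsCont P) {c : ℝ}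
    (h : ∀ p : Y → ℝ, IsDist p → c ≤ -∑ x, q x * log (tilt d ν p x)) :
    ρ * c - relEnt q P ≤ blahutInf P d ρ ν := by
  classical
  refine le_csInf ⟨_, _, isDist_single (Classical.arbitrary Y), rfl⟩ ?_
  rintro _ ⟨p, hp, rfl⟩
  refine le_trans ?_ (sum_mul_log_sub_relEnt_le hq.1 hP hq.2 fun x ↦
    rpow_pos_of_pos (tilt_pos hp d ν x) (-ρ))
  have : ∑ x, q x * log (tilt d ν p x ^ (-ρ)) = ρ * -∑ x, q x * log (tilt d ν p x) := by
    simp only [log_rpow (tilt_pos hp d ν _), mul_neg, ← Finset.sum_neg_distrib, Finset.mul_sum]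
    exact Finset.sum_congr rfl fun x _ ↦ by ring
  rw [this]
  exact sub_le_sub_right (mul_le_mul_of_nonneg_left (h p hp) hρ) _

lemma mul_le_of_mem_blahutValues (hP : IsDist P) (hd : ∀ x y, 0 ≤ d x y)
    (hρ : 0 ≤ ρ) {c : ℝ} (h : ∀ ν, 0 ≤ ν → ∃ p : Y → ℝ, IsDist p ∧
      ∀ x, P x ≠ 0 → exp (c - ν * Δ) ≤ tilt d ν p x) :
    ∀ t ∈ blahutValues P d Δ ρ, ρ * c ≤ t := by
  rintro _ ⟨ν, hν, rfl⟩
  obtain ⟨p, hp, hpt⟩ := h ν hν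
  linarith [blahutInf_le_of_le_tilt hP hd hρ hν hp hpt]

/-- If some letter of positive probability cannot be reproduced within distortion `Δ`, the inner
infimum of the Blahut exponent is not bounded below. -/
lemma sInf_blahutValues_eq_zero [Nonempty Y] (hP : IsDist P) {x : X}
    (hx : P x ≠ 0) (hΔ : ∀ y, Δ < d x y) (hρ : 0 < ρ) : sInf (blahutValues P d Δ ρ) = 0 := by
  classical
  refine sInf_of_not_bddBelow ?_
  rintro ⟨b, hb⟩
  obtain ⟨y, hy⟩ := Finite.exists_min (d x)
  set q : X → ℝ := Pi.single x 1 with hqdef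
  have hq : q ∈ distAbsCont P := single_mem_distAbsCont hx
  have hpos : 0 < ρ * (d x y - Δ) := mul_pos hρ (sub_pos.2 (hΔ y))
  set ν := (|relEnt q P - b| + 1) / (ρ * (d x y - Δ))
  have hν : 0 ≤ ν := by positivity
  have h := sub_relEnt_le_blahutInf (d := d) (ν := ν) (c := ν * d x y) hP hρ.le hq fun p hp ↦ by
    have := log_le_log (tilt_pos hp d ν x) (tilt_le hp hν hy)
    rw [log_exp] at this
    simp only [hqdef, Pi.single_apply, ite_mul, one_mul, zero_mul, Finset.sum_ite_eq',
      Finset.mem_univ, if_true]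
    linarith
  have hb' := hb ⟨ν, hν, rfl⟩
  have h' : ν * (ρ * (d x y - Δ)) = |relEnt q P - b| + 1 := div_mul_cancel₀ _ hpos.ne'
  linarith [le_abs_self (relEnt q P - b)]

lemma sSup_blahutSet_nonpos_of_forall_lt [Nonempty Y] (hP : IsDist P) (hd : ∀ x y, 0 ≤ d x y)
    {x : X} (hx : P x ≠ 0) (hΔ : ∀ y, Δ < d x y) (hR : 0 ≤ R) : sSup (blahutSet P d Δ R) ≤ 0 := by
  rcases hR.eq_or_lt with rfl | hR
  · refine sSup_nonpos ?_
    rintro _ ⟨ρ, hρ, rfl⟩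
    simpa using sInf_blahutValues_nonpos hP hd hρ
  · refine (sSup_of_not_bddAbove ?_).le
    rintro ⟨b, hb⟩
    have hρ : 0 < (|b| + 1) / R := by positivity
    have h := hb ⟨_, hρ.le, rfl⟩
    rw [sInf_blahutValues_eq_zero hP hx hΔ hρ, div_mul_cancel₀ _ hR.ne'] at h
    linarith [le_abs_self b]

/-- The inner infimum of the Blahut exponent is bounded below when every letter of positive
probability can be reproduced within distortion `Δ`. -/
lemma bddBelow_blahutValues [Nonempty Y] (hP : IsDist P) (hd : ∀ x y, 0 ≤ d x y)
    (hfeas : ∀ x, P x ≠ 0 → ∃ y, d x y ≤ Δ) (hρ : 0 ≤ ρ) : BddBelow (blahutValues P d Δ ρ) := by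
  have hcard : (0 : ℝ) < Fintype.card Y := by exact_mod_cast Fintype.card_pos
  refine ⟨_, mul_le_of_mem_blahutValues (c := -log (Fintype.card Y)) hP hd hρ
    fun ν hν ↦ ⟨fun _ ↦ (Fintype.card Y : ℝ)⁻¹, ⟨fun _ ↦ by positivity, by simp⟩, fun x hx ↦ ?_⟩⟩
  obtain ⟨y, hy⟩ := hfeas x hx
  have hterm : exp (-log (Fintype.card Y) - ν * Δ) ≤
      (Fintype.card Y : ℝ)⁻¹ * exp (-ν * d x y) := by
    rw [sub_eq_add_neg, exp_add, exp_neg, exp_log hcard]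
    gcongr
    nlinarith
  exact hterm.trans (Finset.single_le_sum (f := fun y ↦ (Fintype.card Y : ℝ)⁻¹ * exp (-ν * d x y))
    (fun y _ ↦ by positivity) (Finset.mem_univ y))

lemma mul_add_sInf_blahutValues_le_relEnt [Nonempty Y] (hP : IsDist P)
    (hρ : 0 ≤ ρ) (hbdd : BddBelow (blahutValues P d Δ ρ)) {q : X → ℝ} (hq : q ∈ distAbsCont P)
    (hR : R ≤ rateDist d Δ q) : ρ * R + sInf (blahutValues P d Δ ρ) ≤ relEnt q P := by
  refine le_of_forall_pos_le_add fun ε hε ↦ ?_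
  have hb : R - ε / (ρ + 1) < rateDist d Δ q := by
    have : 0 < ε / (ρ + 1) := by positivity
    linarith
  obtain ⟨ν, hν, h⟩ := exists_multiplier_of_lt_rateDist hq.1 hb
  have hle := sub_relEnt_le_blahutInf (d := d) (ν := ν) (c := R - ε / (ρ + 1) + ν * Δ) hP hρ hq
    fun p hp ↦ by
      obtain ⟨V, hV, hVp⟩ := exists_mutInfo_add_le hq.1 hp d ν
      linarith [h V hV]
  have hinf := csInf_le hbdd ⟨ν, hν, rfl⟩
  have hε' : ρ * (ε / (ρ + 1)) ≤ ε := by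
    rw [← mul_div_assoc, div_le_iff₀ (by positivity)]
    nlinarith
  linarith

/-- A single output distribution dominates all inputs when the rate-distortion function is
uniformly small. -/
lemma exists_forall_exp_le_tilt [Nonempty Y] (hP : IsDist P)
    (hfeas : ∀ x, P x ≠ 0 → ∃ y, d x y ≤ Δ) {b : ℝ} (hb : ∀ q ∈ distAbsCont P, rateDist d Δ q < b)
    (hν : 0 ≤ ν) :
    ∃ p : Y → ℝ, IsDist p ∧ ∀ x, P x ≠ 0 → exp (-b - ν * Δ) ≤ tilt d ν p x := by
  classical
  have hlin (w : X → ℝ) : Continuous fun p : Y → ℝ ↦ ∑ x, w x * tilt d ν p x := by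
    unfold tilt
    fun_prop
  have h : ∃ p ∈ {p : Y → ℝ | IsDist p}, ∀ w ∈ distAbsCont P,
      exp (-b - ν * Δ) < ∑ x, w x * tilt d ν p x := by
    refine exists_forall_lt_of_forall_exists_lt (A := distAbsCont P)
      (B := {p : Y → ℝ | IsDist p}) (f := fun w p ↦ ∑ x, w x * tilt d ν p x)
      ⟨P, hP, fun _ h ↦ h⟩ (isCompact_distAbsCont P) convex_isDist
      (fun p _ ↦ by fun_prop) (fun p _ ↦ ⟨convex_distAbsCont P, fun w _ w' _ s t _ _ _ ↦ ?_⟩)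
      (fun w _ ↦ (hlin w).continuousOn)
      (fun w _ ↦ ⟨convex_isDist, fun p _ p' _ s t _ _ _ ↦ ?_⟩) fun w hw ↦ ?_
    · simp only [Pi.add_apply, Pi.smul_apply, smul_eq_mul, add_mul, Finset.sum_add_distrib,
        Finset.mul_sum, mul_assoc, le_refl]
    · simp only [tilt, Pi.add_apply, Pi.smul_apply, smul_eq_mul, Finset.mul_sum,
        ← Finset.sum_add_distrib]
      refine le_of_eq (Finset.sum_congr rfl fun x _ ↦ Finset.sum_congr rfl fun y _ ↦ ?_)
      ring
    · by_contra! hcon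
      have hK : ∀ y, ∑ x, w x * exp (-ν * d x y) ≤ exp (-b - ν * Δ) := fun y ↦ by
        simpa [tilt, Pi.single_apply] using hcon (Pi.single y 1) (isDist_single y)
      choose z hz using fun x ↦ Finite.exists_min (d x)
      refine (hb w hw).not_ge (le_rateDist (isCondDist_single z) ?_ fun V hV hVΔ ↦ ?_)
      · rw [expDist_single]
        refine hw.1.sum_mul_le_of_le fun x hx ↦ ?_
        obtain ⟨y, hy⟩ := hfeas x fun h ↦ hx (hw.2 x h)
        exact (hz x y).trans hy
      · have := neg_log_le_mutInfo_add hw.1 hV (exp_pos _) hK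
        rw [log_exp] at this
        nlinarith
  obtain ⟨p, hp, h⟩ := h
  refine ⟨p, hp, fun x hx ↦ ?_⟩
  simpa [Pi.single_apply] using (h _ (single_mem_distAbsCont hx)).le

lemma sSup_blahutSet_nonpos_of_forall_rateDist_lt [Nonempty Y] (hP : IsDist P)
    (hd : ∀ x y, 0 ≤ d x y) (hfeas : ∀ x, P x ≠ 0 → ∃ y, d x y ≤ Δ)
    (hR : ∀ q ∈ distAbsCont P, rateDist d Δ q < R) : sSup (blahutSet P d Δ R) ≤ 0 := by
  obtain ⟨δ, hδ, h⟩ := exists_forall_rateDist_le_sub hfeas hR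
  refine (sSup_of_not_bddAbove ?_).le
  rintro ⟨b, hb⟩
  have hρ : 0 ≤ (|b| + 1) / (δ / 2) := by positivity
  have h1 := hb ⟨_, hρ, rfl⟩
  have h2 := le_csInf (blahutValues_nonempty P d Δ ((|b| + 1) / (δ / 2)))
    (mul_le_of_mem_blahutValues (c := -(R - δ / 2)) hP hd hρ fun ν hν ↦
      exists_forall_exp_le_tilt hP hfeas (fun q hq ↦ (h q hq).trans_lt (by linarith)) hν)
  have h3 : (|b| + 1) / (δ / 2) * (δ / 2) = |b| + 1 := div_mul_cancel₀ _ (by positivity)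
  linarith [le_abs_self b]

end Blahut

/-- Lemma 1: the Marton exponent dominates the Blahut exponent. -/
theorem marton_ge_blahut
    {X Y : Type*} [Fintype X] [Fintype Y] [Nonempty X] [Nonempty Y]
    (P : X → ℝ) (hP : IsDist P)
    (d : X → Y → ℝ) (hd : ∀ x y, 0 ≤ d x y)
    (Δ : ℝ) (hΔ : 0 ≤ Δ) (R : ℝ) (hR : 0 ≤ R) :
    sSup { v | ∃ ρ : ℝ, 0 ≤ ρ ∧ v = ρ * R + sInf { t | ∃ ν : ℝ, 0 ≤ ν ∧
        t = ρ * ν * Δ - sInf { g | ∃ pY : Y → ℝ, IsDist pY ∧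
          g = Real.log (∑ x, P x * (∑ y, pY y * Real.exp (-ν * d x y)) ^ (-ρ)) } } }
      ≤ sInf { e | ∃ q : X → ℝ, IsDist q ∧ AbsCont q P ∧
          R ≤ rateDist d Δ q ∧ e = relEnt q P } := by
  change sSup (blahutSet P d Δ R) ≤ _
  have hnonneg : ∀ e ∈ { e | ∃ q : X → ℝ, IsDist q ∧ AbsCont q P ∧
      R ≤ rateDist d Δ q ∧ e = relEnt q P }, 0 ≤ e := by
    rintro _ ⟨q, hq, hqP, -, rfl⟩
    exact relEnt_nonneg hq hP hqP
  by_cases hfeas : ∀ x, P x ≠ 0 → ∃ y, d x y ≤ Δ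
  swap
  · push Not at hfeas
    obtain ⟨x, hx, hxΔ⟩ := hfeas
    exact (sSup_blahutSet_nonpos_of_forall_lt hP hd hx hxΔ hR).trans (Real.sInf_nonneg hnonneg)
  by_cases hq : ∃ q ∈ distAbsCont P, R ≤ rateDist d Δ q
  · obtain ⟨q, hq, hqR⟩ := hq
    refine le_csInf ⟨_, q, hq.1, hq.2, hqR, rfl⟩ ?_
    rintro _ ⟨q, hq, hqP, hqR, rfl⟩
    refine Real.sSup_le ?_ (relEnt_nonneg hq hP hqP)
    rintro _ ⟨ρ, hρ, rfl⟩
    exact mul_add_sInf_blahutValues_le_relEnt hP hρ (bddBelow_blahutValues hP hd hfeas hρ)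
      ⟨hq, hqP⟩ hqR
  · push Not at hq
    exact (sSup_blahutSet_nonpos_of_forall_rateDist_lt hP hd hfeas hq).trans
      (Real.sInf_nonneg hnonneg)
end

section
/- For every probability distribution P on 𝒳, every E ≥ 0, and every ν ≥ 0, the max and min may be exchanged: max_{q ∈ 𝒫(𝒳): D(q‖P) ≤ E} min_{p_Y ∈ 𝒫(𝒴)} [ −∑_x q(x) log ∑_y p_Y(y) e^{−ν d(x,y)} ] = min_{p_Y ∈ 𝒫(𝒴)} max_{q ∈ 𝒫(𝒳): D(q‖P) ≤ E} [ −∑_x q(x) log ∑_y p_Y(y) e^{−ν d(x,y)} ]. -/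
open scoped BigOperators

/-- A saddle point makes the sup-inf and inf-sup of a real function agree. -/
theorem IsSaddlePointOn.sSup_sInf_eq_sInf_sSup {E F : Type*} {A : Set E} {B : Set F}
    {f : E → F → ℝ} {a : E} {b : F} (h : IsSaddlePointOn A B f a b) (ha : a ∈ A) (hb : b ∈ B)
    (hA : ∀ q ∈ B, BddBelow ((f · q) '' A)) (hB : ∀ p ∈ A, BddAbove (f p '' B)) :
    sSup ((fun q => sInf ((f · q) '' A)) '' B) = sInf ((fun p => sSup (f p '' B)) '' A) := by
  have hinf : sInf ((f · b) '' A) = f a b := by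
    refine IsLeast.csInf_eq ⟨⟨a, ha, rfl⟩, ?_⟩
    rintro _ ⟨p, hp, rfl⟩
    exact h p hp b hb
  have hsup : sSup (f a '' B) = f a b := by
    refine IsGreatest.csSup_eq ⟨⟨b, hb, rfl⟩, ?_⟩
    rintro _ ⟨q, hq, rfl⟩
    exact h a ha q hq
  trans f a b
  · refine IsGreatest.csSup_eq ⟨⟨b, hb, hinf⟩, ?_⟩
    rintro _ ⟨q, hq, rfl⟩
    exact (csInf_le (hA q hq) ⟨a, ha, rfl⟩).trans (h a ha q hq)
  · symm
    refine IsLeast.csInf_eq ⟨⟨a, ha, hsup⟩, ?_⟩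
    rintro _ ⟨p, hp, rfl⟩
    exact (h p hp b hb).trans (le_csSup (hB p hp) ⟨b, hb, rfl⟩)

theorem relEnt_eq_sum_of_absCont {X : Type*} [Fintype X] {q P : X → ℝ} (h : AbsCont q P) :
    relEnt q P = ∑ x, (q x * Real.log (q x) - q x * Real.log (P x)) := by
  refine Finset.sum_congr rfl fun x _ => ?_
  by_cases hq : q x = 0
  · simp [hq]
  · rw [if_neg hq, Real.log_div hq fun hP => hq (h x hP)]
    ring

theorem relEnt_self {X : Type*} [Fintype X] (P : X → ℝ) : relEnt P P = 0 := by
  have h : AbsCont P P := fun _ => id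
  simp [relEnt_eq_sum_of_absCont h]

/-- The distributions within relative entropy `E` of `P`. -/
def divergenceBall {X : Type*} [Fintype X] (P : X → ℝ) (E : ℝ) : Set (X → ℝ) :=
  {q | IsDist q ∧ AbsCont q P ∧ relEnt q P ≤ E}

theorem divergenceBall_eq {X : Type*} [Fintype X] (P : X → ℝ) (E : ℝ) :
    divergenceBall P E = (stdSimplex ℝ X ∩ {q | AbsCont q P}) ∩
      {q | ∑ x, (q x * Real.log (q x) - q x * Real.log (P x)) ≤ E} := by
  ext q
  constructor
  · rintro ⟨h₁, h₂, h₃⟩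
    exact ⟨⟨h₁, h₂⟩, (relEnt_eq_sum_of_absCont h₂).symm.trans_le h₃⟩
  · rintro ⟨⟨h₁, h₂⟩, h₃⟩
    exact ⟨h₁, h₂, (relEnt_eq_sum_of_absCont h₂).trans_le h₃⟩

theorem isCompact_divergenceBall {X : Type*} [Fintype X] (P : X → ℝ) (E : ℝ) :
    IsCompact (divergenceBall P E) := by
  rw [divergenceBall_eq]
  refine ((isCompact_stdSimplex ℝ X).inter_right ?_).inter_right ?_
  · have : {q : X → ℝ | AbsCont q P} = ⋂ x, ⋂ _ : P x = 0, {q | q x = 0} := by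
      ext q
      simp [AbsCont]
    rw [this]
    exact isClosed_iInter fun x => isClosed_iInter fun _ =>
      isClosed_eq (continuous_apply x) continuous_const
  · refine isClosed_le (continuous_finsetSum _ fun x _ => ?_) continuous_const
    exact (Real.continuous_mul_log.comp (continuous_apply x)).sub
      ((continuous_apply x).mul continuous_const)

theorem convex_divergenceBall {X : Type*} [Fintype X] (P : X → ℝ) (E : ℝ) :
    Convex ℝ (divergenceBall P E) := by
  intro q hq r hr a b ha hb hab
  rw [divergenceBall_eq] at *
  obtain ⟨⟨hq₁, hq₂⟩, hq₃⟩ := hq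
  obtain ⟨⟨hr₁, hr₂⟩, hr₃⟩ := hr
  refine ⟨⟨convex_stdSimplex ℝ X hq₁ hr₁ ha hb hab, fun x hx => ?_⟩, ?_⟩
  · simp [hq₂ x hx, hr₂ x hx]
  · simp only [Set.mem_ofPred_eq] at hq₃ hr₃ ⊢
    calc _ ≤ ∑ x, (a * (q x * Real.log (q x) - q x * Real.log (P x))
            + b * (r x * Real.log (r x) - r x * Real.log (P x))) := by
          refine Finset.sum_le_sum fun x _ => ?_
          have := Real.convexOn_mul_log.2 (hq₁.1 x) (hr₁.1 x) ha hb hab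
          simp only [smul_eq_mul, Pi.add_apply, Pi.smul_apply] at this ⊢
          linarith
      _ = a * ∑ x, (q x * Real.log (q x) - q x * Real.log (P x))
            + b * ∑ x, (r x * Real.log (r x) - r x * Real.log (P x)) := by
          rw [Finset.sum_add_distrib, Finset.mul_sum, Finset.mul_sum]
      _ ≤ a * E + b * E := by gcongr
      _ = E := by rw [← add_mul, hab, one_mul]

theorem sum_mul_pos_of_mem_stdSimplex {Y : Type*} [Fintype Y] {p k : Y → ℝ}
    (hp : p ∈ stdSimplex ℝ Y) (hk : ∀ y, 0 < k y) : 0 < ∑ y, p y * k y := by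
  obtain ⟨y, -, hy⟩ := Finset.exists_ne_zero_of_sum_ne_zero (hp.2.trans_ne one_ne_zero)
  exact Finset.sum_pos' (fun y _ => mul_nonneg (hp.1 y) (hk y).le)
    ⟨y, Finset.mem_univ y, mul_pos ((hp.1 y).lt_of_ne' hy) (hk y)⟩

section LogLoss

variable {X Y : Type*} [Fintype X] [Fintype Y] {k : X → Y → ℝ}

/-- The average negative log-likelihood under `q` of the mixture of the kernel `k` by `p`. -/
noncomputable def mixtureLogLoss (k : X → Y → ℝ) (p : Y → ℝ) (q : X → ℝ) : ℝ :=
  -∑ x, q x * Real.log (∑ y, p y * k x y)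

theorem continuous_mixtureLogLoss_right (k : X → Y → ℝ) (p : Y → ℝ) :
    Continuous (mixtureLogLoss k p) := by
  unfold mixtureLogLoss
  fun_prop

theorem continuousOn_mixtureLogLoss_left (hk : ∀ x y, 0 < k x y) (q : X → ℝ) :
    ContinuousOn (mixtureLogLoss k · q) (stdSimplex ℝ Y) := by
  refine (continuousOn_finsetSum _ fun x _ => continuousOn_const.mul ?_).neg
  refine ContinuousOn.log (by fun_prop) fun p hp => ?_
  exact (sum_mul_pos_of_mem_stdSimplex hp (hk x)).ne'

theorem convexOn_mixtureLogLoss_left (hk : ∀ x y, 0 < k x y) {q : X → ℝ} (hq : ∀ x, 0 ≤ q x) :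
    ConvexOn ℝ (stdSimplex ℝ Y) (mixtureLogLoss k · q) := by
  refine ⟨convex_stdSimplex ℝ Y, fun p hp r hr a b ha hb hab => ?_⟩
  have hsum (x : X) : ∑ y, (a • p + b • r) y * k x y
      = a * ∑ y, p y * k x y + b * ∑ y, r y * k x y := by
    simp only [Pi.add_apply, Pi.smul_apply, smul_eq_mul, add_mul, Finset.sum_add_distrib,
      Finset.mul_sum, mul_assoc]
  simp only [mixtureLogLoss, smul_eq_mul, hsum, mul_neg, ← neg_add, neg_le_neg_iff,
    Finset.mul_sum _ _ a, Finset.mul_sum _ _ b]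
  rw [← Finset.sum_add_distrib]
  refine Finset.sum_le_sum fun x _ => ?_
  have := strictConcaveOn_log_Ioi.concaveOn.2 (sum_mul_pos_of_mem_stdSimplex hp (hk x))
    (sum_mul_pos_of_mem_stdSimplex hr (hk x)) ha hb hab
  simp only [smul_eq_mul, Finset.mul_sum] at this ⊢
  linarith [mul_le_mul_of_nonneg_left this (hq x)]

theorem concaveOn_mixtureLogLoss_right (k : X → Y → ℝ) (p : Y → ℝ) {B : Set (X → ℝ)}
    (hB : Convex ℝ B) : ConcaveOn ℝ B (mixtureLogLoss k p) := by
  refine ⟨hB, fun q _ r _ a b _ _ _ => le_of_eq ?_⟩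
  simp only [mixtureLogLoss, Pi.add_apply, Pi.smul_apply, smul_eq_mul, add_mul,
    Finset.sum_add_distrib, mul_assoc, ← Finset.mul_sum]
  ring

end LogLoss

/-- Lemma 3: exchange of max over `q` (divergence ball) and min over `p_Y`. -/
theorem minimax_exchange
    {X Y : Type*} [Fintype X] [Fintype Y] [Nonempty X] [Nonempty Y]
    (P : X → ℝ) (hP : IsDist P)
    (d : X → Y → ℝ) (hd : ∀ x y, 0 ≤ d x y)
    (E : ℝ) (hE : 0 ≤ E) (ν : ℝ) (hν : 0 ≤ ν) :
    sSup { v | ∃ q : X → ℝ, IsDist q ∧ AbsCont q P ∧ relEnt q P ≤ E ∧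
        v = sInf { w | ∃ pY : Y → ℝ, IsDist pY ∧
          w = -∑ x, q x * Real.log (∑ y, pY y * Real.exp (-ν * d x y)) } }
      = sInf { w | ∃ pY : Y → ℝ, IsDist pY ∧
          w = sSup { v | ∃ q : X → ℝ, IsDist q ∧ AbsCont q P ∧ relEnt q P ≤ E ∧
            v = -∑ x, q x * Real.log (∑ y, pY y * Real.exp (-ν * d x y)) } } := by
  let k : X → Y → ℝ := fun x y => Real.exp (-ν * d x y)
  have hk : ∀ x y, 0 < k x y := fun _ _ => Real.exp_pos _
  have hcB := convex_divergenceBall P E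
  have hkB := isCompact_divergenceBall P E
  have hkA := isCompact_stdSimplex ℝ Y
  have hA : (stdSimplex ℝ Y).Nonempty := by
    classical
    exact ⟨_, single_mem_stdSimplex ℝ (Classical.arbitrary Y)⟩
  have hB : (divergenceBall P E).Nonempty :=
    ⟨P, hP, fun _ h => h, (relEnt_self P).trans_le hE⟩
  obtain ⟨a, ha, b, hb, hab⟩ := Sion.exists_isSaddlePointOn (f := mixtureLogLoss k)
    hA (convex_stdSimplex ℝ Y) hkA
    (fun q _ => (continuousOn_mixtureLogLoss_left hk q).lowerSemicontinuousOn)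
    (fun q hq => (convexOn_mixtureLogLoss_left hk hq.1.1).quasiconvexOn)
    hcB hB hkB
    (fun p _ => (continuous_mixtureLogLoss_right k p).continuousOn.upperSemicontinuousOn)
    (fun p _ => (concaveOn_mixtureLogLoss_right k p hcB).quasiconcaveOn)
  have key := hab.sSup_sInf_eq_sInf_sSup ha hb
    (fun q _ => hkA.bddBelow_image (continuousOn_mixtureLogLoss_left hk q))
    (fun p _ => hkB.bddAbove_image (continuous_mixtureLogLoss_right k p).continuousOn)
  have hsimplex (g : (Y → ℝ) → ℝ) :
      {w | ∃ p, IsDist p ∧ w = g p} = g '' stdSimplex ℝ Y := by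
    ext w
    exact exists_congr fun p => and_congr_right fun _ => eq_comm
  have hball (g : (X → ℝ) → ℝ) :
      {v | ∃ q, IsDist q ∧ AbsCont q P ∧ relEnt q P ≤ E ∧ v = g q}
        = g '' divergenceBall P E := by
    ext v
    simp only [divergenceBall, Set.mem_ofPred_eq, Set.mem_image, and_assoc, eq_comm (a := v)]
  simp only [hsimplex, hball]
  exact key
end
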